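/- arXiv:2408.13261 — 2 statements merged into one kernel-verified Lean document; each statement's English description precedes it below -/
import Mathlib

section
/- (Littlewood's subordination theorem.) Let f and g be analytic on the open unit disk E = {z ∈ ℂ : |z| < 1}, and suppose f is subordinate to g, i.e., there exists an analytic function ω on E with ω(0) = 0 and |ω(z)| < 1 for all z ∈ E such that f(z) = g(ω(z)) for all z ∈ E. Then for every s > 0 and every r with 0 < r < 1, ∫₀^{2π} |f(r e^{iθ})|^s dθ ≤ ∫₀^{2π} |g(r e^{iθ})|^s dθ. -/
open Metric Complex Filter Topology MeromorphicOn
open scoped ComplexConjugate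

/-- The zeros of an analytic function on a closed disk can be removed without changing its
modulus on the boundary circle, provided that there are no zeros on that circle. -/
theorem exists_analyticOnNhd_ne_zero_norm_eq_sphere {g : ℂ → ℂ} {R : ℝ} (hR : 0 < R)
    (hg : AnalyticOnNhd ℂ g (closedBall 0 R)) (hg0 : ∀ z ∈ sphere (0 : ℂ) R, g z ≠ 0) :
    ∃ h : ℂ → ℂ, AnalyticOnNhd ℂ h (closedBall 0 R) ∧ (∀ z ∈ closedBall (0 : ℂ) R, h z ≠ 0) ∧
      ∀ z ∈ sphere (0 : ℂ) R, ‖h z‖ = ‖g z‖ := by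
  have hRmem : (R : ℂ) ∈ sphere (0 : ℂ) R := by simp [hR.le]
  have hconn : IsConnected (closedBall (0 : ℂ) R) :=
    (convex_closedBall 0 R).isConnected (nonempty_closedBall.2 hR.le)
  have htop : ∀ u : closedBall (0 : ℂ) R, meromorphicOrderAt g u ≠ ⊤ := by
    refine (hg.meromorphicOn.exists_meromorphicOrderAt_ne_top_iff_forall hconn).1
      ⟨⟨R, sphere_subset_closedBall hRmem⟩, ?_⟩
    rw [(hg _ (sphere_subset_closedBall hRmem)).meromorphicNFAt.meromorphicOrderAt_eq_zero_iff.2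
      (hg0 _ hRmem)]
    exact WithTop.zero_ne_top
  have hfin := (divisor g (closedBall 0 R)).finiteSupport (isCompact_closedBall 0 R)
  obtain ⟨G, hG, hG0, hEq⟩ := hg.meromorphicOn.extract_zeros_poles htop hfin
  set D := divisor g (closedBall 0 R) with hD
  have hD0 : 0 ≤ D := hg.divisor_nonneg
  have hmem : ∀ u ∈ hfin.toFinset, u ∈ ball (0 : ℂ) R := by
    intro u hu
    have hu' : D u ≠ 0 := by simpa using hu
    have huB : u ∈ closedBall (0 : ℂ) R := D.supportWithinDomain hu'
    by_contra hub
    have hus : u ∈ sphere (0 : ℂ) R := by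
      rw [mem_ball, not_lt] at hub
      exact le_antisymm huB hub
    apply hu'
    rw [hD, hg.meromorphicOn.divisor_apply huB,
      (hg _ huB).meromorphicNFAt.meromorphicOrderAt_eq_zero_iff.2 (hg0 _ hus)]
    rfl
  have hprod : (∏ᶠ u, (· - u) ^ D u : ℂ → ℂ) = fun z ↦ ∏ u ∈ hfin.toFinset, (z - u) ^ D u := by
    rw [finprod_eq_prod_of_mulSupport_subset (s := hfin.toFinset)]
    · ext z; simp
    · rw [Function.FactorizedRational.mulSupport]
      simp
  have hgz : ∀ z ∈ sphere (0 : ℂ) R, g z = (∏ u ∈ hfin.toFinset, (z - u) ^ D u) * G z := by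
    intro z hz
    have hzB := sphere_subset_closedBall hz
    have hPG : AnalyticAt ℂ ((∏ᶠ u, (· - u) ^ D u : ℂ → ℂ) • G) z :=
      (Function.FactorizedRational.analyticAt (hD0 z)).smul (hG z hzB)
    have hacc : AccPt z (𝓟 (closedBall (0 : ℂ) R)) :=
      hconn.isPreconnected.preperfect_of_nontrivial
        ⟨(R : ℂ), sphere_subset_closedBall hRmem, 0, by simp [hR.le], by simpa using hR.ne'⟩ z hzB
    have h1 := (hg z hzB).meromorphicAt.eventuallyEq_nhdsNE_of_eventuallyEq_codiscreteWithin
      hPG.meromorphicAt hzB hacc hEq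
    have h2 := ((hg z hzB).continuousAt.eventuallyEq_nhds_iff_eventuallyEq_nhdsNE
      hPG.continuousAt).1 h1
    have := h2.eq_of_nhds
    rwa [hprod] at this
  have hfactor : ∀ u ∈ ball (0 : ℂ) R, ∀ z ∈ closedBall (0 : ℂ) R,
      ((R : ℂ) ^ 2 - conj u * z) / R ≠ 0 := by
    intro u hu z hz h0
    have hR' : (R : ℂ) ≠ 0 := by exact_mod_cast hR.ne'
    rw [div_eq_zero_iff, or_iff_left hR', sub_eq_zero] at h0
    have h1 := congrArg norm h0
    simp only [norm_pow, norm_mul, RCLike.norm_conj, norm_real, Real.norm_eq_abs, sq_abs] at h1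
    rw [mem_ball_zero_iff] at hu
    rw [mem_closedBall_zero_iff] at hz
    nlinarith [norm_nonneg u, norm_nonneg z]
  refine ⟨fun z ↦ (∏ u ∈ hfin.toFinset, (((R : ℂ) ^ 2 - conj u * z) / R) ^ D u) * G z,
    fun z hz ↦ ?_, fun z hz ↦ ?_, fun z hz ↦ ?_⟩
  · refine AnalyticAt.mul (Finset.analyticAt_fun_prod _ fun u _ ↦ ?_) (hG z hz)
    exact AnalyticAt.fun_zpow_nonneg (by fun_prop) (hD0 u)
  · refine mul_ne_zero (Finset.prod_ne_zero_iff.2 fun u hu ↦ zpow_ne_zero _ ?_) (hG0 ⟨z, hz⟩)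
    exact hfactor u (hmem u hu) z hz
  · rw [hgz z hz, norm_mul, norm_mul, norm_prod, norm_prod]
    congr 1
    refine Finset.prod_congr rfl fun u hu ↦ ?_
    have h1 := norm_canonicalFactor_eval_circle_eq_one (hmem u hu) hz
    have hzu : z - u ≠ 0 := by
      rintro h0
      rw [sub_eq_zero] at h0
      have := hmem u hu
      rw [← h0, mem_ball, mem_sphere.1 hz] at this
      exact lt_irrefl _ this
    rw [canonicalFactor_apply, ← div_div, norm_div, div_eq_one_iff_eq (norm_ne_zero_iff.2 hzu)] at h1
    rw [norm_zpow, norm_zpow, h1]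

/-- If `h` is analytic and zero-free on a closed disk, then `‖h‖ ^ s` is dominated by the Poisson
integral of its boundary values. -/
theorem norm_rpow_le_circleAverage_of_ne_zero {h : ℂ → ℂ} {R s : ℝ} {w : ℂ}
    (hh : AnalyticOnNhd ℂ h (closedBall 0 R)) (hh0 : ∀ z ∈ closedBall (0 : ℂ) R, h z ≠ 0)
    (hw : w ∈ ball (0 : ℂ) R) :
    ‖h w‖ ^ s ≤
      Real.circleAverage ((re ∘ herglotzRieszKernel 0 w) • fun z ↦ ‖h z‖ ^ s) 0 R := by
  have hR : 0 < R := pos_of_mem_ball hw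
  obtain ⟨e, he, hsub⟩ := (isCompact_closedBall (0 : ℂ) R).exists_thickening_subset_open
    (InnerProductSpace.isOpen_setOfPred_harmonicAt (fun z ↦ Real.log ‖h z‖))
    (fun z hz ↦ (hh z hz).harmonicAt_log_norm (hh0 z hz))
  rw [thickening_closedBall he hR.le] at hsub
  obtain ⟨F, hF, hFre⟩ := InnerProductSpace.HarmonicOnNhd.exists_analyticOnNhd_ball_re_eq hsub
  have hsubset : closedBall (0 : ℂ) R ⊆ ball 0 (e + R) := closedBall_subset_ball (by linarith)
  have hnorm : ∀ z ∈ closedBall (0 : ℂ) R, ‖exp (s * F z)‖ = ‖h z‖ ^ s := by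
    intro z hz
    rw [norm_exp, re_ofReal_mul, Real.rpow_def_of_pos (norm_pos_iff.2 (hh0 z hz)), mul_comm s]
    congr 2
    exact hFre (hsubset hz)
  have hE : DifferentiableOn ℂ (fun z ↦ exp (s * F z)) (closure (ball 0 R)) := by
    rw [closure_ball 0 hR.ne']
    have := (hF.mono hsubset).differentiableOn
    fun_prop
  have hav := hE.diffContOnCl.circleAverage_re_herglotzRieszKernel_smul hw
  rw [← hnorm w (ball_subset_closedBall hw), ← hav, Real.circleAverage, Real.circleAverage,
    norm_smul, Real.norm_of_nonneg (by positivity), smul_eq_mul]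
  gcongr
  refine (intervalIntegral.norm_integral_le_integral_norm Real.two_pi_pos.le).trans_eq ?_
  refine intervalIntegral.integral_congr fun θ _ ↦ ?_
  have hθ : circleMap 0 R θ ∈ sphere (0 : ℂ) R := circleMap_mem_sphere 0 hR.le θ
  have hpos : 0 ≤ (herglotzRieszKernel 0 w (circleMap 0 R θ)).re := by
    refine le_trans ?_ (le_re_herglotzRieszKernel hθ hw)
    have : ‖w‖ < R := by simpa using hw
    rw [sub_zero]
    exact div_nonneg (by linarith) (by positivity)
  simp only [Pi.smul_apply', Function.comp_apply, norm_smul, smul_eq_mul,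
    hnorm _ (sphere_subset_closedBall hθ), Real.norm_of_nonneg hpos]

/-- If `g` is analytic on a closed disk and zero-free on its boundary circle, then `‖g‖ ^ s` is
dominated by the Poisson integral of its boundary values. -/
theorem norm_rpow_le_circleAverage_of_ne_zero_sphere {g : ℂ → ℂ} {R s : ℝ} {w : ℂ} (hs : 0 ≤ s)
    (hg : AnalyticOnNhd ℂ g (closedBall 0 R)) (hg0 : ∀ z ∈ sphere (0 : ℂ) R, g z ≠ 0)
    (hw : w ∈ ball (0 : ℂ) R) :
    ‖g w‖ ^ s ≤
      Real.circleAverage ((re ∘ herglotzRieszKernel 0 w) • fun z ↦ ‖g z‖ ^ s) 0 R := by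
  have hR : 0 < R := pos_of_mem_ball hw
  obtain ⟨h, hh, hh0, hgh⟩ := exists_analyticOnNhd_ne_zero_norm_eq_sphere hR hg hg0
  have hwB := ball_subset_closedBall hw
  have hle : ‖g w‖ ≤ ‖h w‖ := by
    have hd : DiffContOnCl ℂ (fun z ↦ g z / h z) (ball 0 R) := by
      refine DifferentiableOn.diffContOnCl ?_
      rw [closure_ball 0 hR.ne']
      exact hg.differentiableOn.div hh.differentiableOn hh0
    have := norm_le_of_forall_mem_frontier_norm_le isBounded_ball hd (C := 1) (fun z hz ↦ ?_)
      (subset_closure hw)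
    · rwa [norm_div, div_le_one (norm_pos_iff.2 (hh0 w hwB))] at this
    · rw [frontier_ball 0 hR.ne'] at hz
      rw [norm_div, hgh z hz, div_self (norm_ne_zero_iff.2 (hg0 z hz))]
  calc ‖g w‖ ^ s ≤ ‖h w‖ ^ s := by gcongr
    _ ≤ _ := norm_rpow_le_circleAverage_of_ne_zero hh hh0 hw
    _ = _ := by
      refine Real.circleAverage_congr_sphere fun z hz ↦ ?_
      rw [abs_of_pos hR] at hz
      simp [hgh z hz]

/-- Subordination inequality between circles of different radii, for `g` zero-free on the larger
circle. -/
theorem circleAverage_norm_comp_rpow_le {g ω : ℂ → ℂ} {r R s : ℝ} (hr : 0 < r) (hR : 0 < R)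
    (hs : 0 < s)
    (hg : AnalyticOnNhd ℂ g (closedBall 0 R)) (hg0 : ∀ z ∈ sphere (0 : ℂ) R, g z ≠ 0)
    (hω : AnalyticOnNhd ℂ ω (closedBall 0 r)) (hω0 : ω 0 = 0)
    (hmaps : Set.MapsTo ω (closedBall 0 r) (ball 0 R)) :
    Real.circleAverage (fun z ↦ ‖g (ω z)‖ ^ s) 0 r ≤
      Real.circleAverage (fun z ↦ ‖g z‖ ^ s) 0 R := by
  have hcont : ContinuousOn (fun z ↦ ‖g z‖ ^ s) (closedBall 0 R) :=
    hg.continuousOn.norm.rpow_const fun _ _ ↦ Or.inr hs.le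
  have hu : CircleIntegrable (fun z ↦ ‖g z‖ ^ s) 0 R :=
    (hcont.mono sphere_subset_closedBall).circleIntegrable hR.le
  have hu' : CircleIntegrable (fun z ↦ ((‖g z‖ ^ s : ℝ) : ℂ)) 0 R :=
    (continuous_ofReal.comp_continuousOn
      (hcont.mono sphere_subset_closedBall)).circleIntegrable hR.le
  let H : ℂ → ℂ := fun w ↦ Real.circleAverage
    (fun ζ ↦ herglotzRieszKernel 0 w ζ • ((‖g ζ‖ ^ s : ℝ) : ℂ)) 0 R
  have hHre (w : ℂ) (hw : w ∈ ball 0 R) : (H w).re =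
      Real.circleAverage ((re ∘ herglotzRieszKernel 0 w) • fun z ↦ ‖g z‖ ^ s) 0 R :=
    re_circleAverage_herglotzRieszKernel_smul hu hw
  have hHω : DifferentiableOn ℂ (H ∘ ω) (closedBall 0 r) :=
    (differentiableOn_circleAverage_herglotzRieszKernel_smul hu').comp hω.differentiableOn hmaps
  have hmean : Real.circleAverage (H ∘ ω) 0 r = H 0 := by
    have hd : DiffContOnCl ℂ (H ∘ ω) (ball 0 |r|) := by
      refine DifferentiableOn.diffContOnCl ?_
      rwa [abs_of_pos hr, closure_ball 0 hr.ne']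
    simpa [hω0] using hd.circleAverage
  have hInt : CircleIntegrable (H ∘ ω) 0 r :=
    (hHω.continuousOn.mono sphere_subset_closedBall).circleIntegrable hr.le
  have hcontω : ContinuousOn (fun z ↦ ‖g (ω z)‖ ^ s) (sphere 0 r) :=
    (hcont.comp hω.continuousOn (hmaps.mono_right ball_subset_closedBall)).mono
      sphere_subset_closedBall
  calc Real.circleAverage (fun z ↦ ‖g (ω z)‖ ^ s) 0 r
      ≤ Real.circleAverage (reCLM ∘ (H ∘ ω)) 0 r := by
        refine Real.circleAverage_mono (hcontω.circleIntegrable hr.le) ?_ fun z hz ↦ ?_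
        · exact ((continuous_re.comp_continuousOn hHω.continuousOn).mono
            sphere_subset_closedBall).circleIntegrable hr.le
        · rw [abs_of_pos hr] at hz
          have hz' := hmaps (sphere_subset_closedBall hz)
          exact (norm_rpow_le_circleAverage_of_ne_zero_sphere hs.le hg hg0 hz').trans_eq
            (hHre _ hz').symm
    _ = (H 0).re := by rw [reCLM.circleAverage_comp_comm hInt, hmean, reCLM_apply]
    _ = Real.circleAverage (fun z ↦ ‖g z‖ ^ s) 0 R := by
        rw [hHre 0 (mem_ball_self hR)]
        refine Real.circleAverage_congr_sphere fun z hz ↦ ?_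
        have hz0 : z ≠ 0 := by
          rintro rfl
          simp [eq_comm, hR.ne'] at hz
        simp [herglotzRieszKernel_def, hz0]

/-- A nonzero analytic function on the unit disk has no zeros on circles of radius slightly
larger than `r`. -/
theorem eventually_forall_sphere_ne_zero {g : ℂ → ℂ} {r : ℝ}
    (hg : AnalyticOnNhd ℂ g (ball 0 1)) (hne : ∃ z ∈ ball (0 : ℂ) 1, g z ≠ 0)
    (hr1 : r < 1) : ∀ᶠ R in 𝓝[>] r, ∀ z ∈ sphere (0 : ℂ) R, g z ≠ 0 := by
  obtain ⟨x, hx, hgx⟩ := hne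
  obtain ⟨t, hrt, ht1⟩ := exists_between hr1
  have hfin : (closedBall (0 : ℂ) t \ g ⁻¹' {0}ᶜ).Finite :=
    (isCompact_closedBall 0 t).finite_sdiff_of_mem_codiscreteWithin
      (Filter.codiscreteWithin_mono (closedBall_subset_ball ht1)
        (hg.preimage_zero_mem_codiscreteWithin hgx hx
          ((convex_ball 0 1).isConnected ⟨x, hx⟩)))
  have hnorms : ((fun z : ℂ ↦ ‖z‖) '' (closedBall (0 : ℂ) t \ g ⁻¹' {0}ᶜ) \ {r}).Finite :=
    (hfin.image _).sdiff
  have hev : ∀ᶠ R in 𝓝[>] r,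
      R ∉ (fun z : ℂ ↦ ‖z‖) '' (closedBall (0 : ℂ) t \ g ⁻¹' {0}ᶜ) \ {r} :=
    nhdsWithin_le_nhds (hnorms.isClosed.isOpen_compl.mem_nhds (by simp))
  filter_upwards [hev, Ioo_mem_nhdsGT hrt] with R hR hRt z hz hgz
  rw [mem_sphere_zero_iff_norm] at hz
  exact hR ⟨⟨z, ⟨by simp [hz, hRt.2.le], by simp [hgz]⟩, hz⟩, hRt.1.ne'⟩

/-- Littlewood's subordination theorem: if `f` is subordinate to `g` on the unit disk,
then the integral means of `f` are dominated by those of `g`. -/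
theorem littlewood_subordination
    (f g ω : ℂ → ℂ)
    (hf : AnalyticOnNhd ℂ f {z : ℂ | ‖z‖ < 1})
    (hg : AnalyticOnNhd ℂ g {z : ℂ | ‖z‖ < 1})
    (hω : AnalyticOnNhd ℂ ω {z : ℂ | ‖z‖ < 1})
    (hω0 : ω 0 = 0)
    (hω1 : ∀ z ∈ {z : ℂ | ‖z‖ < 1}, ‖ω z‖ < 1)
    (hsub : ∀ z ∈ {z : ℂ | ‖z‖ < 1}, f z = g (ω z)) :
    ∀ s : ℝ, 0 < s → ∀ r : ℝ, 0 < r → r < 1 →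
      (∫ θ in (0 : ℝ)..(2 * Real.pi),
        ‖f ((r : ℂ) * Complex.exp ((θ : ℂ) * Complex.I))‖ ^ s) ≤
      ∫ θ in (0 : ℝ)..(2 * Real.pi),
        ‖g ((r : ℂ) * Complex.exp ((θ : ℂ) * Complex.I))‖ ^ s := by
  intro s hs r hr hr1
  have hball : {z : ℂ | ‖z‖ < 1} = ball 0 1 := by ext; simp
  rw [hball] at hg hω hω1 hsub
  suffices h : Real.circleAverage (fun z ↦ ‖g (ω z)‖ ^ s) 0 r ≤
      Real.circleAverage (fun z ↦ ‖g z‖ ^ s) 0 r by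
    rw [Real.circleAverage, Real.circleAverage, smul_eq_mul, smul_eq_mul,
      mul_le_mul_iff_of_pos_left (by positivity)] at h
    simp only [circleMap, zero_add] at h
    refine (intervalIntegral.integral_congr fun θ _ ↦ ?_).trans_le h
    rw [hsub _ (by simpa [abs_of_pos hr] using hr1)]
  have hmem : Set.MapsTo ω (ball 0 1) (ball 0 1) := fun z hz ↦ by simpa using hω1 z hz
  by_cases hne : ∃ z ∈ ball (0 : ℂ) 1, g z ≠ 0
  · have hcont : ContinuousOn (Real.circleAverage (fun z ↦ ‖g z‖ ^ s) 0) (Set.Ico 0 1) := by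
      refine Real.ContinuousOn.circleAverage ?_ fun t ht ↦ ht.1
      refine (hg.continuousOn.norm.rpow_const fun _ _ ↦ Or.inr hs.le).mono fun z hz ↦ ?_
      simpa using hz.2
    have hlim : Tendsto (Real.circleAverage (fun z ↦ ‖g z‖ ^ s) 0) (𝓝[>] r)
        (𝓝 (Real.circleAverage (fun z ↦ ‖g z‖ ^ s) 0 r)) :=
      (hcont.continuousAt (Ico_mem_nhds hr hr1)).tendsto.mono_left nhdsWithin_le_nhds
    refine ge_of_tendsto hlim ?_
    filter_upwards [eventually_forall_sphere_ne_zero hg hne hr1, Ioo_mem_nhdsGT hr1]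
      with R hR hrR
    refine circleAverage_norm_comp_rpow_le hr (hr.trans hrR.1) hs
      (hg.mono (closedBall_subset_ball hrR.2)) hR (hω.mono (closedBall_subset_ball hr1)) hω0
      fun z hz ↦ ?_
    rw [mem_closedBall_zero_iff] at hz
    rw [mem_ball_zero_iff]
    exact (norm_le_norm_of_mapsTo_ball hω.differentiableOn
      (hmem.mono_right ball_subset_closedBall) hω0 (hz.trans_lt hr1)).trans_lt
      (hz.trans_lt hrR.1)
  · push Not at hne
    refine (Real.circleAverage_congr_sphere fun z hz ↦ ?_).le
    have hz' : z ∈ ball (0 : ℂ) 1 := by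
      rw [mem_sphere_zero_iff_norm, abs_of_pos hr] at hz
      simpa [hz] using hr1
    simp [hne z hz', hne _ (hmem hz')]
end

section
/- Let q ∈ (0,1), let A, B be reals with −1 ≤ B < A ≤ 1, let α ≥ 0 be real, and let m > l ≥ 0 be integers. Let f(z) = z − ∑_{k≥2} a_k z^k with all a_k ≥ 0 real, analytic on the open unit disk E, and suppose ∑_{k≥2} μ(k)·a_k ≤ A − B, where μ(k) = (1 + α(1 + |B|))·(([m+1]_q)_{k−1} − ([l+1]_q)_{k−1}) + |B·([m+1]_q)_{k−1} − A·([l+1]_q)_{k−1}|. Define f₂(z) = z − ((A − B)/μ(2))·z², where μ(2) = (1 + α(1 + |B|))·([m+1]_q − [l+1]_q) + |B·[m+1]_q − A·[l+1]_q|. Then for every s > 0 and every r with 0 < r < 1, ∫₀^{2π} |f(r e^{iθ})|^s dθ ≤ ∫₀^{2π} |f₂(r e^{iθ})|^s dθ. -/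
/-- The q-number `[x]_q = (1 - q^x)/(1 - q)` for a real exponent `x`. -/
noncomputable def qNum (q x : ℝ) : ℝ := (1 - q ^ x) / (1 - q)

/-- The q-Pochhammer symbol `([x]_q)_n = ∏_{j=0}^{n-1} [x+j]_q`. -/
noncomputable def qPoch (q x : ℝ) (n : ℕ) : ℝ := ∏ j ∈ Finset.range n, qNum q (x + j)

/-- The q-factorial `[n]_q! = ∏_{j=1}^{n} [j]_q`. -/
noncomputable def qFact (q : ℝ) (n : ℕ) : ℝ := ∏ j ∈ Finset.range n, qNum q (j + 1)

/-- `μ(k) = (1 + α(1+|B|)) (([m+1]_q)_{k-1} - ([l+1]_q)_{k-1})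
      + |B ([m+1]_q)_{k-1} - A ([l+1]_q)_{k-1}|`. -/
noncomputable def mu (q A B α : ℝ) (m l : ℕ) (k : ℕ) : ℝ :=
  (1 + α * (1 + |B|)) * (qPoch q ((m : ℝ) + 1) (k - 1) - qPoch q ((l : ℝ) + 1) (k - 1)) +
    |B * qPoch q ((m : ℝ) + 1) (k - 1) - A * qPoch q ((l : ℝ) + 1) (k - 1)|

/-- The q-Ruscheweyh derivative of order `m` of `z + ∑_{k ≥ 2} c_k z^k`:
`D_q^m f (z) = z + ∑_{k ≥ 2} (([m+1]_q)_{k-1} / [k-1]_q!) c_k z^k`. -/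
noncomputable def DqRus (q : ℝ) (m : ℕ) (c : ℕ → ℂ) (z : ℂ) : ℂ :=
  z + ∑' k : ℕ, ((qPoch q ((m : ℝ) + 1) (k + 1) / qFact q (k + 1) : ℝ) : ℂ) * c (k + 2) * z ^ (k + 2)

open Metric Filter Topology Real in
/-- Pythagoras for the mean-zero holomorphic function `h` and the constant `b`. -/
theorem circleAverage_norm_sq_const_add {h : ℂ → ℂ} {r : ℝ} (hr : 0 < r)
    (hd : DiffContOnCl ℂ h (ball 0 r)) (h0 : h 0 = 0) (b : ℂ) :
    circleAverage (fun z => ‖b + h z‖ ^ 2) 0 r =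
      ‖b‖ ^ 2 + circleAverage (fun z => ‖h z‖ ^ 2) 0 r := by
  have hc : ContinuousOn h (sphere 0 r) :=
    hd.continuousOn_ball.mono sphere_subset_closedBall
  have hmean : circleAverage (fun z => 2 * (starRingEnd ℂ b * h z).re) 0 r = 0 := by
    have h1 : circleAverage (fun z => (2 * starRingEnd ℂ b) * h z) 0 r = 0 := by
      have hd' : DiffContOnCl ℂ (fun z => (2 * starRingEnd ℂ b) * h z) (ball 0 |r|) := by
        rw [abs_of_pos hr]
        exact (diffContOnCl_const (c := 2 * starRingEnd ℂ b)).smul hd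
      rw [hd'.circleAverage, h0, mul_zero]
    have h2 := ContinuousLinearMap.circleAverage_comp_comm (c := 0) (R := r) Complex.reCLM
      (f := fun z => (2 * starRingEnd ℂ b) * h z)
      (ContinuousOn.circleIntegrable hr.le (by fun_prop))
    rw [h1, map_zero] at h2
    rw [← h2]
    congr 1
    ext z
    simp [mul_assoc]
  have hexp : (fun z => ‖b + h z‖ ^ 2) =
      fun z => (‖b‖ ^ 2 + 2 * (starRingEnd ℂ b * h z).re) + ‖h z‖ ^ 2 := by
    ext z
    simp only [← Complex.normSq_eq_norm_sq, Complex.normSq_apply]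
    simp
    ring
  rw [hexp, circleAverage_fun_add, circleAverage_fun_add, hmean, circleAverage_const, add_zero]
  all_goals exact ContinuousOn.circleIntegrable hr.le (by fun_prop)

/-- The `N`-fold backward shift of the power series with coefficients `c`. -/
noncomputable def shiftedSeries (c : ℕ → ℂ) (N : ℕ) (w : ℂ) : ℂ := ∑' n, c (n + N) * w ^ n

theorem summable_norm_shift {c : ℕ → ℂ} {ρ : ℝ} (hρ : 0 < ρ)
    (hc : Summable fun n => ‖c n‖ * ρ ^ n) (N : ℕ) :
    Summable fun n => ‖c (n + N)‖ * ρ ^ n := by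
  have := ((summable_nat_add_iff N).2 hc).mul_right (ρ ^ N)⁻¹
  refine this.congr fun n => ?_
  rw [pow_add]
  field_simp

theorem norm_shift_term_le (c : ℕ → ℂ) {ρ : ℝ} {w : ℂ} (hw : ‖w‖ ≤ ρ) (N n : ℕ) :
    ‖c (n + N) * w ^ n‖ ≤ ‖c (n + N)‖ * ρ ^ n := by
  rw [norm_mul, norm_pow]
  gcongr

theorem shiftedSeries_eq {c : ℕ → ℂ} {ρ : ℝ} (hρ : 0 < ρ)
    (hc : Summable fun n => ‖c n‖ * ρ ^ n) (N : ℕ) {w : ℂ} (hw : ‖w‖ ≤ ρ) :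
    shiftedSeries c N w = c N + w * shiftedSeries c (N + 1) w := by
  have hs : Summable fun n => c (n + N) * w ^ n :=
    .of_norm_bounded (summable_norm_shift hρ hc N) (norm_shift_term_le c hw N)
  rw [shiftedSeries, hs.tsum_eq_zero_add, shiftedSeries, ← tsum_mul_left]
  simp only [zero_add, pow_zero, mul_one]
  congr 2
  ext n
  rw [show n + 1 + N = n + (N + 1) by ring]
  ring

theorem differentiableOn_shiftedSeries {c : ℕ → ℂ} {ρ : ℝ} (hρ : 0 < ρ)
    (hc : Summable fun n => ‖c n‖ * ρ ^ n) (N : ℕ) :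
    DifferentiableOn ℂ (shiftedSeries c N) (Metric.ball 0 ρ) :=
  Complex.differentiableOn_tsum_of_summable_norm (summable_norm_shift hρ hc N)
    (fun n => by fun_prop) Metric.isOpen_ball
    fun n w hw => norm_shift_term_le c (mem_ball_zero_iff.1 hw).le N n

theorem pow_mul_norm_shiftedSeries_le {c : ℕ → ℂ} {r : ℝ} (hr : 0 < r)
    (hc : Summable fun n => ‖c n‖ * r ^ n) (N : ℕ) {w : ℂ} (hw : ‖w‖ ≤ r) :
    r ^ N * ‖shiftedSeries c N w‖ ≤ ∑' n, ‖c (n + N)‖ * r ^ (n + N) := by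
  calc r ^ N * ‖shiftedSeries c N w‖ ≤ r ^ N * ∑' n, ‖c (n + N)‖ * r ^ n := by
        gcongr
        exact tsum_of_norm_bounded (summable_norm_shift hr hc N).hasSum
          (norm_shift_term_le c hw N)
    _ = _ := by
        rw [← tsum_mul_left]
        congr 1
        ext n
        ring

open Metric Filter Topology Real in
/-- Littlewood's subordination principle for square means of a power series. -/
theorem circleAverage_norm_sq_shiftedSeries_comp_le {c : ℕ → ℂ} {ρ r : ℝ} (hr : 0 < r)
    (hrρ : r < ρ) (hc : Summable fun n => ‖c n‖ * ρ ^ n) {ω : ℂ → ℂ}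
    (hω : DifferentiableOn ℂ ω (ball 0 ρ)) (hωle : ∀ z ∈ ball (0 : ℂ) ρ, ‖ω z‖ ≤ ‖z‖) :
    circleAverage (fun z => ‖shiftedSeries c 0 (ω z)‖ ^ 2) 0 r ≤
      circleAverage (fun z => ‖shiftedSeries c 0 z‖ ^ 2) 0 r := by
  have hρ : 0 < ρ := hr.trans hrρ
  have hcr : Summable fun n => ‖c n‖ * r ^ n :=
    .of_nonneg_of_le (fun n => by positivity) (fun n => by gcongr) hc
  have hsub : closedBall (0 : ℂ) r ⊆ ball 0 ρ := closedBall_subset_ball hrρ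
  have hsphere : sphere (0 : ℂ) r ⊆ ball 0 ρ := sphere_subset_closedBall.trans hsub
  have comp {η : ℂ → ℂ} (hη : DifferentiableOn ℂ η (ball 0 ρ))
      (hle : ∀ z ∈ ball (0 : ℂ) ρ, ‖η z‖ ≤ ‖z‖) (N : ℕ) :
      DifferentiableOn ℂ (fun z => shiftedSeries c N (η z)) (ball 0 ρ) :=
    (differentiableOn_shiftedSeries hρ hc N).comp hη fun z hz =>
      mem_ball_zero_iff.2 ((hle z hz).trans_lt (mem_ball_zero_iff.1 hz))
  have pyth {η : ℂ → ℂ} (hη : DifferentiableOn ℂ η (ball 0 ρ))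
      (hle : ∀ z ∈ ball (0 : ℂ) ρ, ‖η z‖ ≤ ‖z‖) (N : ℕ) :
      circleAverage (fun z => ‖shiftedSeries c N (η z)‖ ^ 2) 0 r =
        ‖c N‖ ^ 2 + circleAverage (fun z => ‖η z * shiftedSeries c (N + 1) (η z)‖ ^ 2) 0 r := by
    rw [← circleAverage_norm_sq_const_add hr]
    · refine circleAverage_congr_sphere fun z hz => ?_
      rw [abs_of_pos hr] at hz
      have hz' := hsphere hz
      rw [shiftedSeries_eq hρ hc N ((hle z hz').trans (mem_ball_zero_iff.1 hz').le)]
    · exact ((hη.mul (comp hη hle (N + 1))).mono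
        (closure_ball_subset_closedBall.trans hsub)).diffContOnCl
    · have := hle 0 (mem_ball_self hρ)
      rw [norm_zero, norm_le_zero_iff] at this
      simp [this]
  have integrable {η : ℂ → ℂ} (hη : DifferentiableOn ℂ η (ball 0 ρ))
      (hle : ∀ z ∈ ball (0 : ℂ) ρ, ‖η z‖ ≤ ‖z‖) (N : ℕ) :
      CircleIntegrable (fun z => ‖shiftedSeries c N (η z)‖ ^ 2) 0 r :=
    ContinuousOn.circleIntegrable hr.le
      (((comp hη hle N).continuousOn.mono hsphere).norm.pow 2)
  have hid : ∀ z ∈ ball (0 : ℂ) ρ, ‖(fun z => z) z‖ ≤ ‖z‖ := fun z _ => le_rfl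
  have step (N : ℕ) : circleAverage (fun z => ‖shiftedSeries c N (ω z)‖ ^ 2) 0 r -
        circleAverage (fun z => ‖shiftedSeries c N z‖ ^ 2) 0 r ≤
      r ^ 2 * (circleAverage (fun z => ‖shiftedSeries c (N + 1) (ω z)‖ ^ 2) 0 r -
        circleAverage (fun z => ‖shiftedSeries c (N + 1) z‖ ^ 2) 0 r) := by
    have e1 : circleAverage (fun z => ‖z * shiftedSeries c (N + 1) z‖ ^ 2) 0 r =
        r ^ 2 * circleAverage (fun z => ‖shiftedSeries c (N + 1) z‖ ^ 2) 0 r := by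
      rw [← smul_eq_mul, ← circleAverage_fun_smul]
      refine circleAverage_congr_sphere fun z hz => ?_
      rw [abs_of_pos hr, mem_sphere_zero_iff_norm] at hz
      simp [mul_pow, hz]
    have e2 : circleAverage (fun z => ‖ω z * shiftedSeries c (N + 1) (ω z)‖ ^ 2) 0 r ≤
        r ^ 2 * circleAverage (fun z => ‖shiftedSeries c (N + 1) (ω z)‖ ^ 2) 0 r := by
      rw [← smul_eq_mul, ← circleAverage_fun_smul]
      refine circleAverage_mono ?_ ?_ fun z hz => ?_
      · exact ContinuousOn.circleIntegrable hr.le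
          (((hω.mul (comp hω hωle (N + 1))).continuousOn.mono hsphere).norm.pow 2)
      · exact (integrable hω hωle (N + 1)).const_fun_smul
      · rw [abs_of_pos hr] at hz
        have hz' := hωle z (hsphere hz)
        rw [mem_sphere_zero_iff_norm.1 hz] at hz'
        rw [norm_mul, mul_pow, smul_eq_mul]
        gcongr
    rw [pyth hω hωle N, pyth (η := fun z => z) differentiableOn_id hid N, e1]
    linarith
  have iter (N : ℕ) : circleAverage (fun z => ‖shiftedSeries c 0 (ω z)‖ ^ 2) 0 r -
        circleAverage (fun z => ‖shiftedSeries c 0 z‖ ^ 2) 0 r ≤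
      (r ^ 2) ^ N * (circleAverage (fun z => ‖shiftedSeries c N (ω z)‖ ^ 2) 0 r -
        circleAverage (fun z => ‖shiftedSeries c N z‖ ^ 2) 0 r) := by
    induction N with
    | zero => simp
    | succ N ih =>
      refine ih.trans ?_
      rw [pow_succ (r ^ 2), mul_assoc]
      gcongr
      exact step N
  have bound (N : ℕ) : circleAverage (fun z => ‖shiftedSeries c 0 (ω z)‖ ^ 2) 0 r -
        circleAverage (fun z => ‖shiftedSeries c 0 z‖ ^ 2) 0 r ≤
      (∑' n, ‖c (n + N)‖ * r ^ (n + N)) ^ 2 := by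
    have hnn : 0 ≤ circleAverage (fun z => ‖shiftedSeries c N z‖ ^ 2) 0 r :=
      circleAverage_nonneg_of_nonneg fun z _ => by positivity
    calc _ ≤ (r ^ 2) ^ N * circleAverage (fun z => ‖shiftedSeries c N (ω z)‖ ^ 2) 0 r :=
          (iter N).trans (by gcongr; linarith)
      _ = circleAverage (fun z => (r ^ 2) ^ N • ‖shiftedSeries c N (ω z)‖ ^ 2) 0 r := by
          rw [circleAverage_fun_smul, smul_eq_mul]
      _ ≤ _ := by
          refine circleAverage_mono_on_of_le_circle
            (integrable hω hωle N).const_fun_smul fun z hz => ?_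
          rw [abs_of_pos hr] at hz
          have hz' := hωle z (hsphere hz)
          rw [mem_sphere_zero_iff_norm.1 hz] at hz'
          rw [smul_eq_mul, ← pow_mul, mul_comm 2, pow_mul, ← mul_pow]
          gcongr
          exact pow_mul_norm_shiftedSeries_le hr hcr N hz'
  have lim : Tendsto (fun N => (∑' n, ‖c (n + N)‖ * r ^ (n + N)) ^ 2) atTop (𝓝 0) := by
    simpa using (tendsto_sum_nat_add fun n => ‖c n‖ * r ^ n).pow 2
  linarith [ge_of_tendsto' lim bound]

open Metric Real in
/-- Littlewood's subordination principle for square means. -/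
theorem circleAverage_norm_sq_comp_le {g ω : ℂ → ℂ} {r : ℝ} (hr : 0 < r) (hr1 : r < 1)
    (hg : DifferentiableOn ℂ g (ball 0 1)) (hω : DifferentiableOn ℂ ω (ball 0 1))
    (hωle : ∀ z ∈ ball (0 : ℂ) 1, ‖ω z‖ ≤ ‖z‖) :
    circleAverage (fun z => ‖g (ω z)‖ ^ 2) 0 r ≤ circleAverage (fun z => ‖g z‖ ^ 2) 0 r := by
  obtain ⟨ρ, hrρ, hρ1⟩ := exists_between hr1
  have hρ : 0 < ρ := hr.trans hrρ
  set c : ℕ → ℂ := fun n => (n.factorial : ℂ)⁻¹ * iteratedDeriv n g 0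
  have hsum {z : ℂ} (hz : z ∈ ball (0 : ℂ) 1) : HasSum (fun n => c n * z ^ n) (g z) := by
    have := Complex.hasSum_taylorSeries_on_ball (r := 1) (by simpa using hg) (by simpa using hz)
    refine this.congr_fun fun n => ?_
    simp [c]
    ring
  have hgc {z : ℂ} (hz : z ∈ ball (0 : ℂ) 1) : g z = shiftedSeries c 0 z :=
    (hsum hz).tsum_eq.symm
  have hc : Summable fun n => ‖c n‖ * ρ ^ n := by
    have := (hsum (z := ρ) (by simpa [abs_of_pos hρ] using hρ1)).summable.norm
    simpa [abs_of_pos hρ] using this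
  have hsub : ball (0 : ℂ) ρ ⊆ ball 0 1 := ball_subset_ball hρ1.le
  have hsphere : sphere (0 : ℂ) |r| ⊆ ball 0 1 := by
    rw [abs_of_pos hr]
    exact sphere_subset_closedBall.trans (closedBall_subset_ball hr1)
  have := circleAverage_norm_sq_shiftedSeries_comp_le hr hrρ hc (hω.mono hsub)
    fun z hz => hωle z (hsub hz)
  rwa [circleAverage_congr_sphere (f₁ := fun z => ‖g (ω z)‖ ^ 2)
      (f₂ := fun z => ‖shiftedSeries c 0 (ω z)‖ ^ 2),
    circleAverage_congr_sphere (f₁ := fun z => ‖g z‖ ^ 2)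
      (f₂ := fun z => ‖shiftedSeries c 0 z‖ ^ 2)]
  · intro z hz
    simp only [hgc (hsphere hz)]
  · intro z hz
    beta_reduce
    rw [hgc (mem_ball_zero_iff.2 ((hωle z (hsphere hz)).trans_lt
      (mem_ball_zero_iff.1 (hsphere hz))))]

theorem one_le_qNum {q : ℝ} (hq : q ∈ Set.Ioo (0 : ℝ) 1) {x : ℝ} (hx : 1 ≤ x) :
    1 ≤ qNum q x := by
  have h1 : (0 : ℝ) < 1 - q := sub_pos.2 hq.2
  rw [qNum, le_div_iff₀ h1]
  have := Real.rpow_le_rpow_of_exponent_ge hq.1 hq.2.le hx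
  rw [Real.rpow_one] at this
  linarith

theorem qNum_lt_qNum {q : ℝ} (hq : q ∈ Set.Ioo (0 : ℝ) 1) {x y : ℝ} (hxy : x < y) :
    qNum q x < qNum q y := by
  have h1 : (0 : ℝ) < 1 - q := sub_pos.2 hq.2
  have := Real.rpow_lt_rpow_of_exponent_gt hq.1 hq.2 hxy
  unfold qNum
  gcongr

theorem qPoch_one (q x : ℝ) : qPoch q x 1 = qNum q x := by
  simp [qPoch]

theorem qPoch_succ (q x : ℝ) (n : ℕ) : qPoch q x (n + 1) = qPoch q x n * qNum q (x + n) :=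
  Finset.prod_range_succ _ _

theorem one_le_qPoch {q : ℝ} (hq : q ∈ Set.Ioo (0 : ℝ) 1) {x : ℝ} (hx : 1 ≤ x) (n : ℕ) :
    1 ≤ qPoch q x n := by
  induction n with
  | zero => simp [qPoch]
  | succ n ih =>
    rw [qPoch_succ]
    exact one_le_mul_of_one_le_of_one_le ih (one_le_qNum hq (by linarith [n.cast_nonneg (α := ℝ)]))

theorem qPoch_le_qPoch {q : ℝ} (hq : q ∈ Set.Ioo (0 : ℝ) 1) {x y : ℝ} (hx : 1 ≤ x)
    (hxy : x < y) (n : ℕ) : qPoch q x n ≤ qPoch q y n := by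
  induction n with
  | zero => simp [qPoch]
  | succ n ih =>
    rw [qPoch_succ, qPoch_succ]
    have h1 := one_le_qPoch hq hx n
    have h2 := one_le_qNum hq (x := x + n) (by linarith [n.cast_nonneg (α := ℝ)])
    have h3 := (qNum_lt_qNum hq (add_lt_add_left hxy (n : ℝ))).le
    exact mul_le_mul ih h3 (by linarith) (by linarith)

/-- If `uP - vQ` is nonnegative, it grows when `P` and `Q` are scaled by `p ≥ t ≥ 1`. -/
theorem sub_le_sub_of_scale {u v P Q p t : ℝ} (hu : 0 ≤ u) (hP : 0 ≤ P)
    (htp : t ≤ p) (ht : 1 ≤ t) (h : 0 ≤ u * P - v * Q) :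
    u * P - v * Q ≤ u * (P * p) - v * (Q * t) := by
  have h1 : 0 ≤ (t - 1) * (u * P - v * Q) := mul_nonneg (by linarith) h
  have h2 : 0 ≤ (p - t) * (u * P) := mul_nonneg (by linarith) (mul_nonneg hu hP)
  linarith

theorem sub_add_abs_le_of_scale {A B P Q p t : ℝ} (hB : -1 ≤ B) (hB1 : B ≤ 1)
    (hP : 0 ≤ P) (hQP : Q ≤ P) (htp : t ≤ p) (ht : 1 ≤ t) :
    P - Q + |B * P - A * Q| ≤ P * p - Q * t + |B * (P * p) - A * (Q * t)| := by
  have hpos := abs_nonneg (B * P - A * Q)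
  have h1 := le_abs_self (B * (P * p) - A * (Q * t))
  have h2 := neg_abs_le (B * (P * p) - A * (Q * t))
  rcases abs_choice (B * P - A * Q) with h | h <;> rw [h] at hpos ⊢
  · have := sub_le_sub_of_scale (u := 1 + B) (v := 1 + A) (Q := Q) (by linarith) hP htp ht
      (by linarith)
    linarith
  · have := sub_le_sub_of_scale (u := 1 - B) (v := 1 - A) (Q := Q) (by linarith) hP htp ht
      (by linarith)
    linarith

theorem mu_le_mu_succ {q A B α : ℝ} (hq : q ∈ Set.Ioo (0 : ℝ) 1) (hB : -1 ≤ B) (hB1 : B ≤ 1)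
    (hα : 0 ≤ α) {m l : ℕ} (hml : l < m) (k : ℕ) :
    mu q A B α m l (k + 2) ≤ mu q A B α m l (k + 3) := by
  have hl : (1 : ℝ) ≤ (l : ℝ) + 1 := by linarith [l.cast_nonneg (α := ℝ)]
  have hlm : (l : ℝ) + 1 < (m : ℝ) + 1 := by gcongr
  simp only [mu, show k + 2 - 1 = k + 1 by omega, show k + 3 - 1 = k + 1 + 1 by omega]
  rw [qPoch_succ q _ (k + 1), qPoch_succ q _ (k + 1)]
  have hP := one_le_qPoch hq (hl.trans hlm.le) (k + 1)
  have hQP := qPoch_le_qPoch hq hl hlm (k + 1)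
  have ht := one_le_qNum hq (x := (l : ℝ) + 1 + (k + 1 : ℕ))
    (by linarith [(k + 1).cast_nonneg (α := ℝ)])
  have htp := (qNum_lt_qNum hq (add_lt_add_left hlm ((k + 1 : ℕ) : ℝ))).le
  have h1 := sub_add_abs_le_of_scale (A := A) hB hB1 (by linarith) hQP htp ht
  have h2 := sub_le_sub_of_scale (P := qPoch q (m + 1) (k + 1)) (Q := qPoch q (l + 1) (k + 1))
    zero_le_one (v := 1) (by linarith) htp ht (by linarith)
  have h3 := mul_le_mul_of_nonneg_left h2 (a := α * (1 + |B|)) (by positivity)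
  linarith

theorem mu_two_le {q A B α : ℝ} (hq : q ∈ Set.Ioo (0 : ℝ) 1) (hB : -1 ≤ B) (hB1 : B ≤ 1)
    (hα : 0 ≤ α) {m l : ℕ} (hml : l < m) (k : ℕ) :
    mu q A B α m l 2 ≤ mu q A B α m l (k + 2) :=
  monotone_nat_of_le_succ (f := fun k => mu q A B α m l (k + 2))
    (mu_le_mu_succ hq hB hB1 hα hml) (Nat.zero_le k)

theorem sub_lt_mu_two {q A B α : ℝ} (hq : q ∈ Set.Ioo (0 : ℝ) 1) (hBA : B < A) (hA : A ≤ 1)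
    (hα : 0 ≤ α) {m l : ℕ} (hml : l < m) : A - B < mu q A B α m l 2 := by
  have hl : (1 : ℝ) ≤ (l : ℝ) + 1 := by linarith [l.cast_nonneg (α := ℝ)]
  have hlm : (l : ℝ) + 1 < (m : ℝ) + 1 := by gcongr
  simp only [mu, show 2 - 1 = 1 by omega, qPoch_one]
  have hQ := one_le_qNum hq hl
  have hQP := qNum_lt_qNum hq hlm
  have h1 := neg_abs_le (B * qNum q (m + 1) - A * qNum q (l + 1))
  have h2 : 0 ≤ α * (1 + |B|) * (qNum q (m + 1) - qNum q (l + 1)) :=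
    mul_nonneg (by positivity) (by linarith)
  nlinarith [mul_pos (show 0 < 1 - B by linarith) (sub_pos.2 hQP),
    mul_nonneg (show 0 ≤ A - B by linarith) (sub_nonneg.2 hQ)]

open Metric Real in
/-- Littlewood's subordination principle for the powers of `‖1 - κ z‖`, where `0 ≤ κ < 1`. -/
theorem circleAverage_norm_one_sub_mul_rpow_comp_le {κ r s : ℝ} (hκ : 0 ≤ κ) (hκ1 : κ < 1)
    (hr : 0 < r) (hr1 : r < 1) {ω : ℂ → ℂ} (hω : DifferentiableOn ℂ ω (ball 0 1))
    (hωle : ∀ z ∈ ball (0 : ℂ) 1, ‖ω z‖ ≤ ‖z‖) :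
    circleAverage (fun z => ‖1 - κ * ω z‖ ^ s) 0 r ≤
      circleAverage (fun z => ‖1 - (κ : ℂ) * z‖ ^ s) 0 r := by
  have hslit : ∀ z ∈ ball (0 : ℂ) 1, 1 - (κ : ℂ) * z ∈ Complex.slitPlane := by
    intro z hz
    left
    have h1 := (Complex.re_le_norm z).trans_lt (mem_ball_zero_iff.1 hz)
    simp only [Complex.sub_re, Complex.one_re, Complex.re_ofReal_mul]
    nlinarith
  have hg : DifferentiableOn ℂ (fun z => (1 - (κ : ℂ) * z) ^ ((s / 2 : ℝ) : ℂ)) (ball 0 1) :=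
    DifferentiableOn.cpow_const (by fun_prop) hslit
  have hsq (w : ℂ) : ‖w ^ ((s / 2 : ℝ) : ℂ)‖ ^ 2 = ‖w‖ ^ s := by
    rw [Complex.norm_cpow_real, ← rpow_mul_natCast (norm_nonneg w)]
    norm_num
  simpa only [hsq] using circleAverage_norm_sq_comp_le hr hr1 hg hω hωle

/-- Theorem 6.1 (integral mean inequality): the integral means of `f` are dominated by those of
`f₂(z) = z - ((A-B)/μ(2)) z²`. -/
theorem integral_mean_inequality
    (q A B α : ℝ) (hq : q ∈ Set.Ioo (0 : ℝ) 1)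
    (hB : -1 ≤ B) (hBA : B < A) (hA : A ≤ 1) (hα : 0 ≤ α)
    (m l : ℕ) (hml : l < m)
    (a : ℕ → ℝ) (ha : ∀ k, 0 ≤ a k) (f : ℂ → ℂ)
    (hanal : AnalyticOnNhd ℂ f {z : ℂ | ‖z‖ < 1})
    (hconv : ∀ z ∈ {z : ℂ | ‖z‖ < 1},
      Summable (fun k : ℕ => a (k + 2) * ‖z‖ ^ (k + 2)))
    (hfa : ∀ z ∈ {z : ℂ | ‖z‖ < 1},
      f z = z - ∑' k : ℕ, (a (k + 2) : ℂ) * z ^ (k + 2))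
    (hsummable : Summable (fun k : ℕ => mu q A B α m l (k + 2) * a (k + 2)))
    (hsum : ∑' k : ℕ, mu q A B α m l (k + 2) * a (k + 2) ≤ A - B)
    (f₂ : ℂ → ℂ)
    (hf₂ : ∀ z : ℂ, f₂ z = z - (((A - B) / mu q A B α m l 2 : ℝ) : ℂ) * z ^ 2) :
    ∀ s : ℝ, 0 < s → ∀ r : ℝ, 0 < r → r < 1 →
      (∫ θ in (0 : ℝ)..(2 * Real.pi),
        ‖f ((r : ℂ) * Complex.exp ((θ : ℂ) * Complex.I))‖ ^ s) ≤
      ∫ θ in (0 : ℝ)..(2 * Real.pi),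
        ‖f₂ ((r : ℂ) * Complex.exp ((θ : ℂ) * Complex.I))‖ ^ s := by
  intro s hs r hr hr1
  set μ₂ := mu q A B α m l 2
  have hB1 : B ≤ 1 := hBA.le.trans hA
  have hABμ : A - B < μ₂ := sub_lt_mu_two hq hBA hA hα hml
  have hμpos : 0 < μ₂ := (sub_pos.2 hBA).trans hABμ
  set κ := (A - B) / μ₂ with hκdef
  have hκ : 0 < κ := div_pos (sub_pos.2 hBA) hμpos
  have hκ1 : κ < 1 := (div_lt_one hμpos).2 hABμ
  have hterm (k : ℕ) : μ₂ * a (k + 2) ≤ mu q A B α m l (k + 2) * a (k + 2) :=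
    mul_le_mul_of_nonneg_right (mu_two_le hq hB hB1 hα hml k) (ha _)
  have hμa : Summable fun k : ℕ => μ₂ * a (k + 2) :=
    .of_nonneg_of_le (fun k => mul_nonneg hμpos.le (ha _)) hterm hsummable
  have hasum : Summable fun k : ℕ => a (k + 2) := (summable_mul_left_iff hμpos.ne').1 hμa
  have hale : ∑' k : ℕ, a (k + 2) ≤ κ := by
    rw [hκdef, le_div_iff₀ hμpos, mul_comm, ← tsum_mul_left]
    exact (hμa.tsum_le_tsum hterm hsummable).trans hsum
  set F : ℂ → ℂ := fun z => ∑' k : ℕ, (a (k + 2) : ℂ) * z ^ (k + 1)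
  have hFterm (k : ℕ) (z : ℂ) (hz : z ∈ Metric.ball (0 : ℂ) 1) :
      ‖(a (k + 2) : ℂ) * z ^ (k + 1)‖ ≤ a (k + 2) * ‖z‖ := by
    rw [norm_mul, norm_pow, Complex.norm_of_nonneg (ha _)]
    refine mul_le_mul_of_nonneg_left ?_ (ha _)
    exact pow_le_of_le_one (norm_nonneg z) (mem_ball_zero_iff.1 hz).le k.succ_ne_zero
  have hFd : DifferentiableOn ℂ F (Metric.ball 0 1) :=
    Complex.differentiableOn_tsum_of_summable_norm hasum (fun k => by fun_prop) Metric.isOpen_ball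
      fun k z hz => (hFterm k z hz).trans
        (mul_le_of_le_one_right (ha _) (mem_ball_zero_iff.1 hz).le)
  have hωle : ∀ z ∈ Metric.ball (0 : ℂ) 1, ‖F z / κ‖ ≤ ‖z‖ := by
    intro z hz
    rw [norm_div, Complex.norm_of_nonneg hκ.le, div_le_iff₀ hκ, mul_comm]
    calc ‖F z‖ ≤ (∑' k : ℕ, a (k + 2)) * ‖z‖ :=
          tsum_of_norm_bounded (hasum.hasSum.mul_right _) fun k => hFterm k z hz
      _ ≤ κ * ‖z‖ := by gcongr
  have hf : ∀ z ∈ Metric.ball (0 : ℂ) 1, f z = z * (1 - κ * (F z / κ)) := by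
    intro z hz
    rw [hfa z (mem_ball_zero_iff.1 hz), mul_div_cancel₀ _ (by exact_mod_cast hκ.ne'),
      mul_sub, mul_one, ← tsum_mul_left]
    congr 2
    ext k
    ring
  have hmem (θ : ℝ) : (r : ℂ) * Complex.exp (θ * Complex.I) ∈ Metric.ball (0 : ℂ) 1 := by
    simpa [abs_of_pos hr, Complex.norm_exp_ofReal_mul_I] using hr1
  have hnorm (θ : ℝ) : ‖(r : ℂ) * Complex.exp (θ * Complex.I)‖ = r := by
    simp [abs_of_pos hr, Complex.norm_exp_ofReal_mul_I]
  have key := circleAverage_norm_one_sub_mul_rpow_comp_le (s := s) hκ.le hκ1 hr hr1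
    (hFd.div_const (κ : ℂ)) hωle
  simp only [Real.circleAverage_def, circleMap_zero, smul_eq_mul] at key
  have key' := le_of_mul_le_mul_left key (by positivity)
  have e₁ (θ : ℝ) : ‖f (r * Complex.exp (θ * Complex.I))‖ ^ s = r ^ s *
      ‖1 - κ * (F (r * Complex.exp (θ * Complex.I)) / κ)‖ ^ s := by
    rw [hf _ (hmem θ), norm_mul, Real.mul_rpow (norm_nonneg _) (norm_nonneg _), hnorm]
  have e₂ (θ : ℝ) : ‖f₂ (r * Complex.exp (θ * Complex.I))‖ ^ s = r ^ s *
      ‖1 - (κ : ℂ) * (r * Complex.exp (θ * Complex.I))‖ ^ s := by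
    rw [hf₂, ← hnorm θ, ← Real.mul_rpow (norm_nonneg _) (norm_nonneg _), ← norm_mul, hnorm]
    congr 2
    ring
  simp only [e₁, e₂, intervalIntegral.integral_const_mul]
  exact mul_le_mul_of_nonneg_left key' (by positivity)
end
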